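/- Consider the strategic-form game with player set $\{0\} \cup \mathbb{N}$ in which player $0$'s action set is $A = \mathbb{N} \times \{0,1\}$, each player $i \in \mathbb{N}$ has action set $X_i = \{0,1\}$, and player $0$'s payoff is $u((n,j),x) = 1$ if $x_n = j$ and $u((n,j),x) = 0$ otherwise. Then the minmax value satisfies $v = \inf_{\sigma \in \Sigma} \sup_{a \in A} \mathbb{E}_{\delta_a \otimes \sigma}[u] = \tfrac12$, while the finitistic minmax value satisfies $v^* = \inf_{\sigma \in \Sigma^*} \sup_{a \in A} \mathbb{E}_{\delta_a \otimes \sigma}[u] = 1$; in particular $v < v^*$. -/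

import Mathlib

open MeasureTheory

/-- `μ` is the product of the measures `μs i`: the measure of every measurable
cylinder is the product of the measures of its sides. -/
def IsProductMeasure {X : ℕ → Type*} [∀ i, MeasurableSpace (X i)]
    (μ : Measure (Π i, X i)) (μs : ∀ i, Measure (X i)) : Prop :=
  ∀ (I : Finset ℕ) (s : ∀ i, Set (X i)), (∀ i, MeasurableSet (s i)) →
    μ ((I : Set ℕ).pi s) = ∏ i ∈ I, μs i (s i)

/-- The set `Σ` of product Borel probability measures on `{0,1}^ℕ`. -/
def ProductProbSet : Set (Measure (Π _ : ℕ, Bool)) :=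
  {σ | ∃ σs : ℕ → Measure Bool,
    (∀ i, IsProbabilityMeasure (σs i)) ∧ IsProductMeasure σ σs}

/-- The set `Σ*` of product Borel probability measures on `{0,1}^ℕ` in which all but
finitely many factors are Dirac measures. -/
def FinitisticProductProbSet : Set (Measure (Π _ : ℕ, Bool)) :=
  {σ | ∃ σs : ℕ → Measure Bool,
    (∀ i, IsProbabilityMeasure (σs i)) ∧ IsProductMeasure σ σs ∧
    {i | ¬ ∃ b : Bool, σs i = Measure.dirac b}.Finite}

/-- Player 0's payoff: action `(n, j)` yields `1` if opponent `n` plays `j`,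
and `0` otherwise. -/
noncomputable def payoff (a : ℕ × Bool) (x : Π _ : ℕ, Bool) : ℝ :=
  if x a.1 = a.2 then 1 else 0

lemma payoff_integral {σ : Measure (Π _ : ℕ, Bool)} {σs : ℕ → Measure Bool}
    (h : IsProductMeasure σ σs) (a : ℕ × Bool) :
    ∫ x, payoff a x ∂σ = (σs a.1).real {a.2} := by
  have h1 : (fun x => payoff a x) =
      Set.indicator {x : Π _ : ℕ, Bool | x a.1 = a.2} (fun _ => (1 : ℝ)) := by
    funext x
    simp [payoff, Set.indicator_apply]
  have hm : MeasurableSet {x : Π _ : ℕ, Bool | x a.1 = a.2} :=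
    measurableSet_eq_fun (measurable_pi_apply a.1) measurable_const
  rw [h1, integral_indicator_const _ hm]
  have h2 := h {a.1} (fun _ => {a.2}) (fun _ => measurableSet_singleton _)
  have h3 : ((({a.1} : Finset ℕ) : Set ℕ).pi (fun _ => ({a.2} : Set Bool))) =
      {x : Π _ : ℕ, Bool | x a.1 = a.2} := by
    ext x; simp
  rw [h3, Finset.prod_singleton] at h2
  simp [Measure.real, h2]

lemma payoff_bdd {σ : Measure (Π _ : ℕ, Bool)} {σs : ℕ → Measure Bool}
    (hp : ∀ i, IsProbabilityMeasure (σs i)) (h : IsProductMeasure σ σs) :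
    BddAbove (Set.range fun a : ℕ × Bool => ∫ x, payoff a x ∂σ) := by
  refine ⟨1, ?_⟩
  rintro _ ⟨a, rfl⟩
  have := hp a.1
  simp only [payoff_integral h a]
  exact measureReal_le_one

lemma isProduct_infinitePi (σs : ℕ → Measure Bool) [∀ i, IsProbabilityMeasure (σs i)] :
    IsProductMeasure (Measure.infinitePi σs) σs := by
  intro I s hs
  exact Measure.infinitePi_pi σs (fun i _ => hs i)

lemma ge_half (σ : ProductProbSet) :
    1 / 2 ≤ ⨆ a : ℕ × Bool, ∫ x, payoff a x ∂(σ : Measure (Π _ : ℕ, Bool)) := by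
  obtain ⟨σ, σs, hp, h⟩ := σ
  have b := payoff_bdd hp h
  have h1 := le_ciSup b (0, true)
  have h2 := le_ciSup b (0, false)
  simp only [payoff_integral h] at h1 h2 ⊢
  have := hp 0
  have h3 : (σs 0).real {true} + (σs 0).real {false} = 1 := by
    have := probReal_add_probReal_compl (μ := σs 0) (measurableSet_singleton true)
    rwa [show ({true} : Set Bool)ᶜ = {false} by ext b; cases b <;> simp] at this
  linarith

lemma eq_one (σ : FinitisticProductProbSet) :
    ⨆ a : ℕ × Bool, ∫ x, payoff a x ∂(σ : Measure (Π _ : ℕ, Bool)) = 1 := by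
  obtain ⟨σ, σs, hp, h, hf⟩ := σ
  apply le_antisymm
  · apply ciSup_le
    intro a
    have := hp a.1
    simp only [payoff_integral h a]
    exact measureReal_le_one
  · obtain ⟨n, hn⟩ := hf.exists_notMem
    simp only [Set.mem_ofPred_eq, not_not] at hn
    obtain ⟨b, hb⟩ := hn
    have h1 := le_ciSup (payoff_bdd hp h) (n, b)
    rw [payoff_integral h (n, b)] at h1
    simpa [hb, Measure.real] using h1

lemma val_half : (⨅ σ : ProductProbSet, ⨆ a : ℕ × Bool,
    ∫ x, payoff a x ∂(σ : Measure (Π _ : ℕ, Bool))) = 1 / 2 := by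
  have hP : IsProbabilityMeasure ((2⁻¹ : ENNReal) • (Measure.count : Measure Bool)) :=
    ⟨by
      rw [Measure.smul_apply, Measure.count_univ]
      simpa using ENNReal.inv_mul_cancel (a := 2) (by simp) (by simp)⟩
  have hprod := isProduct_infinitePi (fun _ => (2⁻¹ : ENNReal) • (Measure.count : Measure Bool))
  let σ₀ : ProductProbSet := ⟨_, _, fun _ => hP, hprod⟩
  apply le_antisymm
  · refine (ciInf_le ⟨1 / 2, ?_⟩ σ₀).trans ?_
    · rintro _ ⟨σ, rfl⟩
      exact ge_half σ
    · apply ciSup_le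
      intro a
      rw [payoff_integral hprod a]
      simp [Measure.real]
  · have : Nonempty ProductProbSet := ⟨σ₀⟩
    exact le_ciInf ge_half

lemma val_one : (⨅ σ : FinitisticProductProbSet, ⨆ a : ℕ × Bool,
    ∫ x, payoff a x ∂(σ : Measure (Π _ : ℕ, Bool))) = 1 := by
  have : Nonempty FinitisticProductProbSet :=
    ⟨⟨_, fun _ => Measure.dirac true, fun _ => inferInstance,
      isProduct_infinitePi (fun _ => Measure.dirac true), by simp⟩⟩
  simp only [eq_one, ciInf_const]

/-- In the game where player 0 names an opponent and an action, the minmax value is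
`1/2` while the finitistic minmax value is `1`; in particular they differ. -/
theorem minmax_lt_finitistic_minmax_example :
    (⨅ σ : ProductProbSet, ⨆ a : ℕ × Bool,
        ∫ x, payoff a x ∂(σ : Measure (Π _ : ℕ, Bool))) = 1 / 2 ∧
    (⨅ σ : FinitisticProductProbSet, ⨆ a : ℕ × Bool,
        ∫ x, payoff a x ∂(σ : Measure (Π _ : ℕ, Bool))) = 1 ∧
    (⨅ σ : ProductProbSet, ⨆ a : ℕ × Bool,
        ∫ x, payoff a x ∂(σ : Measure (Π _ : ℕ, Bool))) <
      ⨅ σ : FinitisticProductProbSet, ⨆ a : ℕ × Bool,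
        ∫ x, payoff a x ∂(σ : Measure (Π _ : ℕ, Bool)) := by
  refine ⟨val_half, val_one, ?_⟩
  rw [val_half, val_one]
  norm_num
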